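/- (i) X is isomorphic to its contragredient X^∨ as a k-representation of G. (ii) A finite-dimensional k-representation V of G satisfies V^† = V and (V^∨)^† = V^∨ if and only if there exist integers ℓ, m ≥ 1 and a G-equivariant map f : X^m → X^ℓ such that V is isomorphic to the image of f. -/

import Mathlib

/-!
STATEMENT 4.
`k` is a field, `G` a finite group, `U ≤ G` a subgroup and
`X = ind_U^G(1) = k[U\G]` the permutation representation of `G` (by right
translation) on the left-`U`-invariant functions `G → k`.
For a finite-dimensional representation `V` of `G`: `V^U` is the subspace of
`U`-invariants, `V^†` the subrepresentation generated by `V^U`, and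
`V^∨ = Hom_k(V,k)` the contragredient.

Claim:
(i) `X ≅ X^∨` as representations of `G`;
(ii) `V^† = V` and `(V^∨)^† = V^∨` if and only if there are `ℓ, m ≥ 1` and a
`G`-equivariant map `f : X^m → X^ℓ` with `V ≅ image f` (as representations of `G`).
-/

section Stmt4

variable (k : Type*) [Field k] (G : Type*) [Group G] [Fintype G] (U : Subgroup G)

/-- Right translation of functions on `G`, as a linear map. -/
def rtran (g : G) : (G → k) →ₗ[k] (G → k) where
  toFun f := fun x => f (x * g)
  map_add' f₁ f₂ := rfl
  map_smul' c f := rfl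

/-- `X = ind_U^G(1)`: the space of functions on `U\G`, i.e. of left `U`-invariant
functions on `G`. -/
def indOne : Submodule k (G → k) where
  carrier := {f | ∀ (u : U) (g : G), f (↑u * g) = f g}
  add_mem' := by
    intro f₁ f₂ h₁ h₂ u g
    simp only [Pi.add_apply, h₁ u g, h₂ u g]
  zero_mem' := by intro u g; rfl
  smul_mem' := by
    intro c f hf u g
    simp only [Pi.smul_apply, hf u g]

theorem indOne_stable (g : G) (f : G → k) (hf : f ∈ indOne k G U) :
    rtran k G g f ∈ indOne k G U := by
  intro u x
  simpa [rtran, mul_assoc] using hf u (x * g)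

/-- The representation of `G` on `X = ind_U^G(1)` by right translation. -/
def indOneRep : Representation k G ↥(indOne k G U) where
  toFun g := (rtran k G g).restrict (fun f hf => indOne_stable k G U g f hf)
  map_one' := by
    apply LinearMap.ext; intro f
    apply Subtype.ext
    funext x
    simp [rtran, LinearMap.restrict_apply]
  map_mul' g h := by
    apply LinearMap.ext; intro f
    apply Subtype.ext
    funext x
    simp [rtran, LinearMap.restrict_apply, mul_assoc]

variable {V : Type*} [AddCommGroup V] [Module k V]

/-- The `U`-invariants of a representation of `G`. -/
def invariantsU (ρ : Representation k G V) : Submodule k V where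
  carrier := {v | ∀ u : U, ρ ↑u v = v}
  add_mem' := by intro a b ha hb u; rw [map_add, ha u, hb u]
  zero_mem' := by intro u; rw [map_zero]
  smul_mem' := by intro c a ha u; rw [map_smul, ha u]

/-- `V^†`: the subrepresentation of `V` generated by the `U`-invariants. -/
def dagger (ρ : Representation k G V) : Submodule k V :=
  Submodule.span k {w | ∃ g : G, ∃ v ∈ invariantsU k G U ρ, w = ρ g v}

end Stmt4

section IndOne

variable (k : Type*) [Field k] (G : Type*) [Group G] [Fintype G] (U : Subgroup G)

/-- Inversion identifies left `U`-invariant functions on `G` with functions on `G ⧸ U`. -/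
noncomputable def indOneEquiv : ↥(indOne k G U) ≃ₗ[k] (G ⧸ U → k) where
  toFun f q := (f : G → k) q.out⁻¹
  map_add' _ _ := rfl
  map_smul' _ _ := rfl
  invFun F := ⟨fun x => F (x⁻¹ : G), fun u g => by
    have h : (((u : G) * g)⁻¹ : G) = g⁻¹ * ((u⁻¹ : U) : G) := by simp
    simp only [h, QuotientGroup.mk_mul_of_mem _ (u⁻¹).2]⟩
  left_inv f := by
    apply Subtype.ext
    funext x
    obtain ⟨u, hu⟩ := QuotientGroup.mk_out_eq_mul U x⁻¹
    change (f : G → k) ((x⁻¹ : G) : G ⧸ U).out⁻¹ = _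
    rw [hu, mul_inv_rev, inv_inv]
    exact f.2 u⁻¹ x
  right_inv F := by
    funext q
    simp

theorem indOneEquiv_symm_apply (F : G ⧸ U → k) (x : G) :
    ((indOneEquiv k G U).symm F : G → k) x = F (x⁻¹ : G) := rfl

theorem indOneRep_apply (g : G) (f : ↥(indOne k G U)) (x : G) :
    (indOneRep k G U g f : G → k) x = (f : G → k) (x * g) := rfl

theorem indOneRep_indOneEquiv_symm (g : G) (F : G ⧸ U → k) :
    indOneRep k G U g ((indOneEquiv k G U).symm F) =
      (indOneEquiv k G U).symm (fun q => F (g⁻¹ • q)) := by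
  apply Subtype.ext
  funext x
  simp only [indOneRep_apply, indOneEquiv_symm_apply, mul_inv_rev]
  rfl

theorem indOneEquiv_indOneRep (g : G) (f : ↥(indOne k G U)) :
    indOneEquiv k G U (indOneRep k G U g f) = fun q => indOneEquiv k G U f (g⁻¹ • q) := by
  obtain ⟨F, rfl⟩ := (indOneEquiv k G U).symm.surjective f
  rw [indOneRep_indOneEquiv_symm]
  simp

theorem exists_indOne_equiv_dual :
    ∃ φ : ↥(indOne k G U) ≃ₗ[k] Module.Dual k ↥(indOne k G U),
      ∀ (g : G) (f : ↥(indOne k G U)),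
        φ (indOneRep k G U g f) = (indOneRep k G U).dual g (φ f) := by
  classical
  refine ⟨(indOneEquiv k G U).trans
    ((dotProductEquiv k (G ⧸ U)).trans (indOneEquiv k G U).dualMap), fun g f => ?_⟩
  ext h
  simp only [LinearEquiv.trans_apply, LinearEquiv.dualMap_apply, dotProductEquiv_apply_apply,
    Representation.dual_apply, Module.Dual.transpose_apply, LinearMap.comp_apply,
    indOneEquiv_indOneRep, dotProduct, inv_inv]
  refine Fintype.sum_equiv (MulAction.toPerm g⁻¹) _ _ fun q => ?_
  simp

variable {k G} {V : Type*} [AddCommGroup V] [Module k V] (ρ : Representation k G V)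

theorem apply_mk_out {v : V} (hv : v ∈ invariantsU k G U ρ) (g : G) :
    ρ (g : G ⧸ U).out v = ρ g v := by
  obtain ⟨u, hu⟩ := QuotientGroup.mk_out_eq_mul U g
  rw [hu, map_mul, Module.End.mul_apply, hv u]

theorem apply_smul_out {v : V} (hv : v ∈ invariantsU k G U ρ) (g : G) (q : G ⧸ U) :
    ρ (g • q).out v = ρ g (ρ q.out v) := by
  have h : g • q = ((g * q.out : G) : G ⧸ U) := by
    conv_lhs => rw [← QuotientGroup.out_eq' q]
    rfl
  rw [h, apply_mk_out U ρ hv, map_mul, Module.End.mul_apply]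

open scoped Classical in
/-- The equivariant map `X → V` attached to a `U`-invariant vector by Frobenius reciprocity. -/
noncomputable def fromIndOne (v : V) : ↥(indOne k G U) →ₗ[k] V :=
  (Fintype.linearCombination k fun q : G ⧸ U => ρ q.out v) ∘ₗ (indOneEquiv k G U).toLinearMap

theorem fromIndOne_indOneRep {v : V} (hv : v ∈ invariantsU k G U ρ) (g : G)
    (f : ↥(indOne k G U)) :
    fromIndOne U ρ v (indOneRep k G U g f) = ρ g (fromIndOne U ρ v f) := by
  classical
  simp only [fromIndOne, LinearMap.comp_apply, LinearEquiv.coe_coe, indOneEquiv_indOneRep,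
    Fintype.linearCombination_apply, map_sum, map_smul]
  refine Fintype.sum_equiv (MulAction.toPerm g⁻¹) _ _ fun q => ?_
  rw [← apply_smul_out U ρ hv]
  simp

theorem apply_mem_range_fromIndOne {v : V} (hv : v ∈ invariantsU k G U ρ) (g : G) :
    ∃ f, fromIndOne U ρ v f = ρ g v := by
  classical
  refine ⟨(indOneEquiv k G U).symm (Pi.single (g : G ⧸ U) 1), ?_⟩
  simp [fromIndOne, Fintype.linearCombination_apply_single, apply_mk_out U ρ hv]

/-- The equivariant map `V → X` attached to a `U`-invariant functional by Frobenius reciprocity. -/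
def toIndOne (l : ↥(invariantsU k G U ρ.dual)) : V →ₗ[k] ↥(indOne k G U) :=
  (LinearMap.pi fun x => (l : Module.Dual k V) ∘ₗ ρ x).codRestrict (indOne k G U) fun v u g => by
    have h := LinearMap.congr_fun (l.2 u⁻¹) (ρ g v)
    simpa [Representation.dual_apply, Module.Dual.transpose_apply] using h

theorem toIndOne_apply (l : ↥(invariantsU k G U ρ.dual)) (v : V) (x : G) :
    (toIndOne U ρ l v : G → k) x = (l : Module.Dual k V) (ρ x v) := rfl

theorem toIndOne_equivariant (l : ↥(invariantsU k G U ρ.dual)) (g : G) (v : V) :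
    toIndOne U ρ l (ρ g v) = indOneRep k G U g (toIndOne U ρ l v) := by
  apply Subtype.ext
  funext x
  simp [toIndOne_apply, indOneRep_apply]

theorem exists_fin_succ_generating_family {M : Type*} [AddCommGroup M] [Module k M]
    [FiniteDimensional k M] (N : Submodule k M) :
    ∃ (n : ℕ) (s : Fin (n + 1) → M), Submodule.span k (Set.range s) = N := by
  obtain ⟨n, s, hs⟩ := Submodule.fg_iff_exists_fin_generating_family.1
    (IsNoetherian.noetherian N)
  exact ⟨n, Fin.cons 0 s, by rw [Fin.range_cons, Submodule.span_insert_zero, hs]⟩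

theorem exists_surjective_of_dagger_eq_top [FiniteDimensional k V] (h : dagger k G U ρ = ⊤) :
    ∃ (n : ℕ) (p : (Fin (n + 1) → ↥(indOne k G U)) →ₗ[k] V), Function.Surjective p ∧
      ∀ g x, p (fun i => indOneRep k G U g (x i)) = ρ g (p x) := by
  obtain ⟨n, s, hs⟩ := exists_fin_succ_generating_family (invariantsU k G U ρ)
  have hmem i : s i ∈ invariantsU k G U ρ := hs ▸ Submodule.subset_span ⟨i, rfl⟩
  let p := LinearMap.lsum k (fun _ : Fin (n + 1) => ↥(indOne k G U)) k
    fun i => fromIndOne U ρ (s i)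
  have hp x : p x = ∑ i, fromIndOne U ρ (s i) (x i) := by simp [p]
  refine ⟨n, p, ?_, fun g x => ?_⟩
  · rw [← LinearMap.range_eq_top, eq_top_iff, ← h]
    refine Submodule.span_le.2 ?_
    rintro _ ⟨g, v, hv, rfl⟩
    have hle : invariantsU k G U ρ ≤ (LinearMap.range p).comap (ρ g) := by
      rw [← hs, Submodule.span_le]
      rintro _ ⟨i, rfl⟩
      obtain ⟨f, hf⟩ := apply_mem_range_fromIndOne U ρ (hmem i) g
      refine ⟨Pi.single i f, ?_⟩
      rw [← hf, LinearMap.lsum_piSingle]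
    exact hle hv
  · simp only [hp, map_sum, fromIndOne_indOneRep U ρ (hmem _)]

theorem exists_injective_of_dagger_dual_eq_top [FiniteDimensional k V]
    (h : dagger k G U ρ.dual = ⊤) :
    ∃ (n : ℕ) (j : V →ₗ[k] (Fin (n + 1) → ↥(indOne k G U))), Function.Injective j ∧
      ∀ g v, j (ρ g v) = fun i => indOneRep k G U g (j v i) := by
  obtain ⟨n, s, hs⟩ := exists_fin_succ_generating_family (invariantsU k G U ρ.dual)
  have hmem i : s i ∈ invariantsU k G U ρ.dual := hs ▸ Submodule.subset_span ⟨i, rfl⟩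
  refine ⟨n, LinearMap.pi fun i => toIndOne U ρ ⟨s i, hmem i⟩, ?_, fun g v => ?_⟩
  · rw [injective_iff_map_eq_zero]
    intro v hv
    have hsv (i) (x : G) : s i (ρ x v) = 0 := congr_arg (fun y => (y i : G → k) x) hv
    rw [← Module.forall_dual_apply_eq_zero_iff k]
    intro l
    have hl : l ∈ dagger k G U ρ.dual := h ▸ Submodule.mem_top
    suffices hle : dagger k G U ρ.dual ≤ LinearMap.ker (Module.Dual.eval k V v) from hle hl
    refine Submodule.span_le.2 ?_
    rintro _ ⟨g, t, ht, rfl⟩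
    have hle : invariantsU k G U ρ.dual ≤ LinearMap.ker (Module.Dual.eval k V (ρ g⁻¹ v)) := by
      rw [← hs, Submodule.span_le]
      rintro _ ⟨i, rfl⟩
      exact hsv i g⁻¹
    exact hle ht
  · funext i
    exact toIndOne_equivariant U ρ _ g v

theorem apply_mem_dagger (T : ↥(indOne k G U) →ₗ[k] V)
    (hT : ∀ g x, T (indOneRep k G U g x) = ρ g (T x)) (x : ↥(indOne k G U)) :
    T x ∈ dagger k G U ρ := by
  classical
  let e := (indOneEquiv k G U).symm
  have hδ (g : G) : indOneRep k G U g (e (Pi.single ((1 : G) : G ⧸ U) 1)) =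
      e (Pi.single (g : G ⧸ U) 1) := by
    rw [indOneRep_indOneEquiv_symm]
    congr 1
    funext q
    have hq : g⁻¹ • q = ((1 : G) : G ⧸ U) ↔ q = (g : G ⧸ U) := by
      rw [inv_smul_eq_iff, MulAction.Quotient.smul_coe, smul_eq_mul, mul_one]
    simp only [Pi.single_apply, hq]
  obtain ⟨F, rfl⟩ := e.surjective x
  rw [← Finset.univ_sum_single F, map_sum, map_sum]
  refine Submodule.sum_mem _ fun q _ => ?_
  obtain ⟨g, rfl⟩ := QuotientGroup.mk_surjective q
  rw [← mul_one (F _), ← smul_eq_mul, Pi.single_smul, map_smul, map_smul]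
  refine Submodule.smul_mem _ _ (Submodule.subset_span
    ⟨g, T (e (Pi.single ((1 : G) : G ⧸ U) 1)), fun u => ?_, ?_⟩)
  · rw [← hT, hδ, show ((u : G) : G ⧸ U) = (1 : G) from QuotientGroup.eq.2 (by simp)]
  · rw [← hT, hδ]

theorem dagger_eq_top_of_surjective {m : ℕ} (p : (Fin m → ↥(indOne k G U)) →ₗ[k] V)
    (hp : Function.Surjective p)
    (hpG : ∀ g x, p (fun i => indOneRep k G U g (x i)) = ρ g (p x)) :
    dagger k G U ρ = ⊤ := by
  refine eq_top_iff.2 fun v _ => ?_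
  obtain ⟨x, rfl⟩ := hp v
  rw [← Finset.univ_sum_single x, map_sum]
  refine Submodule.sum_mem _ fun i _ => ?_
  refine apply_mem_dagger U ρ (p ∘ₗ LinearMap.single k (fun _ => ↥(indOne k G U)) i) (fun g y => ?_) (x i)
  simp only [LinearMap.comp_apply, LinearMap.single_apply, ← hpG]
  congr 1
  funext j
  exact (Pi.apply_single (fun _ => indOneRep k G U g) (fun _ => map_zero _) i y j).symm

theorem dagger_dual_eq_top_of_injective [FiniteDimensional k V] {l : ℕ}
    (j : V →ₗ[k] (Fin l → ↥(indOne k G U))) (hj : Function.Injective j)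
    (hjG : ∀ g v, j (ρ g v) = fun i => indOneRep k G U g (j v i)) :
    dagger k G U ρ.dual = ⊤ := by
  let t (i : Fin l) : Module.Dual k V :=
    LinearMap.proj 1 ∘ₗ (indOne k G U).subtype ∘ₗ LinearMap.proj i ∘ₗ j
  have ht (i) (g : G) (v : V) : t i (ρ g v) = (j v i : G → k) g := by
    simp [t, hjG, indOneRep_apply]
  have hinv (i) : t i ∈ invariantsU k G U ρ.dual := fun u => by
    ext v
    have h := (j v i).2 u⁻¹ 1
    simp only [mul_one] at h
    simp only [Representation.dual_apply, Module.Dual.transpose_apply, LinearMap.comp_apply, ht]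
    exact h
  have hbot : (dagger k G U ρ.dual).dualCoannihilator = ⊥ := by
    refine eq_bot_iff.2 fun v hv => hj ?_
    rw [map_zero]
    funext i
    apply Subtype.ext
    funext g
    have h := (Submodule.mem_dualCoannihilator _).1 hv _
      (Submodule.subset_span ⟨g⁻¹, t i, hinv i, rfl⟩)
    simpa [Representation.dual_apply, Module.Dual.transpose_apply, ht] using h
  rw [← Subspace.dualCoannihilator_dualAnnihilator_eq (W := dagger k G U ρ.dual), hbot,
    Submodule.dualAnnihilator_bot]

end IndOne

theorem stmt_4
    (k : Type*) [Field k] (G : Type*) [Group G] [Fintype G] (U : Subgroup G) :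
    -- (i) X ≅ X^∨ as representations of G
    (∃ φ : ↥(indOne k G U) ≃ₗ[k] Module.Dual k ↥(indOne k G U),
       ∀ (g : G) (f : ↥(indOne k G U)),
         φ (indOneRep k G U g f) = (indOneRep k G U).dual g (φ f)) ∧
    -- (ii) for every finite-dimensional representation V of G :
    (∀ (V : Type) (_ : AddCommGroup V) (_ : Module k V) (_ : FiniteDimensional k V)
       (ρ : Representation k G V),
       -- V^† = V and (V^∨)^† = V^∨
       (dagger k G U ρ = ⊤ ∧ dagger k G U ρ.dual = ⊤) ↔
       -- iff V is the image of a G-equivariant map f : X^m → X^ℓ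
       (∃ m ℓ : ℕ, 1 ≤ m ∧ 1 ≤ ℓ ∧
         ∃ f : (Fin m → ↥(indOne k G U)) →ₗ[k] (Fin ℓ → ↥(indOne k G U)),
           (∀ (g : G) (x : Fin m → ↥(indOne k G U)),
             f (fun i => indOneRep k G U g (x i)) =
               fun j => indOneRep k G U g (f x j)) ∧
           ∃ eqv : V ≃ₗ[k] ↥(LinearMap.range f),
             ∀ (g : G) (v : V),
               (↑(eqv (ρ g v)) : Fin ℓ → ↥(indOne k G U)) =
                 fun j => indOneRep k G U g ((eqv v : Fin ℓ → ↥(indOne k G U)) j))) := by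
  refine ⟨exists_indOne_equiv_dual k G U, fun V _ _ _ ρ => ⟨fun ⟨h₁, h₂⟩ => ?_, ?_⟩⟩
  · obtain ⟨m, p, hp, hpG⟩ := exists_surjective_of_dagger_eq_top U ρ h₁
    obtain ⟨l, j, hj, hjG⟩ := exists_injective_of_dagger_dual_eq_top U ρ h₂
    refine ⟨m + 1, l + 1, by omega, by omega, j ∘ₗ p, fun g x => ?_,
      (LinearEquiv.ofInjective j hj).trans (LinearEquiv.ofEq _ _ ?_), fun g v => ?_⟩
    · simp only [LinearMap.comp_apply, hpG, hjG]
    · rw [LinearMap.range_comp_of_range_eq_top _ (LinearMap.range_eq_top.2 hp)]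
    · exact hjG g v
  · rintro ⟨m, l, -, -, f, hf, e, he⟩
    refine ⟨dagger_eq_top_of_surjective U ρ (e.symm.toLinearMap ∘ₗ f.rangeRestrict)
      (e.symm.surjective.comp f.surjective_rangeRestrict) fun g x => e.injective ?_,
      dagger_dual_eq_top_of_injective U ρ ((LinearMap.range f).subtype ∘ₗ e.toLinearMap)
        (Subtype.val_injective.comp e.injective) he⟩
    apply Subtype.ext
    rw [he]
    simp [hf]
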